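/- Let m > 0 and let λ ∈ ℝ with m·sinh m + λ(1 − cosh m) ≠ 0. Then H_m(t,s) > 0 for all t, s ∈ (0,1) if and only if 0 ≤ λ < m·sinh m/(cosh m − 1). -/

import Mathlib

open Set

/-- Green's function for `u'' − m²u + σ = 0`, `u(0)=0`, `u(1)=λ∫₀¹u`. -/
noncomputable def Hm (m lam t s : ℝ) : ℝ :=
  if s ≤ t then
    (Real.sinh (m * s) *
        (Real.sinh (m - m * t) * (m * Real.sinh m + lam * (1 - Real.cosh m)) -
          lam * Real.sinh (m * t)) -
      lam * Real.sinh (m * t) * (Real.sinh (m - m * s) - Real.sinh m)) /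
      (m * Real.sinh m * (m * Real.sinh m + lam * (1 - Real.cosh m)))
  else
    (Real.sinh (m * t) *
        (Real.sinh (m - m * s) * (m * Real.sinh m - lam * Real.cosh m) -
          lam * (Real.sinh (m * s) - Real.sinh m))) /
      (m * Real.sinh m * (m * Real.sinh m + lam * (1 - Real.cosh m)))

theorem aux_K (m s : ℝ) (hm : 0 < m) (h0 : 0 < s) (h1 : s < 1) :
    0 < Real.sinh m - Real.sinh (m * s) - Real.sinh (m - m * s) := by
  have ha : 0 < m * s := mul_pos hm h0
  have hb : 0 < m - m * s := by nlinarith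
  have e : Real.sinh m = Real.sinh (m * s + (m - m * s)) := by congr 1; ring
  rw [e, Real.sinh_add]
  have h1 := Real.one_lt_cosh.2 ha.ne'
  have h2 := Real.one_lt_cosh.2 hb.ne'
  have h3 := Real.sinh_pos_iff.2 ha
  have h4 := Real.sinh_pos_iff.2 hb
  nlinarith [mul_pos h3 (sub_pos.2 h2), mul_pos h4 (sub_pos.2 h1)]

theorem stmt_16 (m lam : ℝ) (hm : 0 < m)
    (hD : m * Real.sinh m + lam * (1 - Real.cosh m) ≠ 0) :
    (∀ t ∈ Ioo (0:ℝ) 1, ∀ s ∈ Ioo (0:ℝ) 1, Hm m lam t s > 0) ↔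
      (0 ≤ lam ∧ lam < m * Real.sinh m / (Real.cosh m - 1)) := by
  have hS : 0 < Real.sinh m := Real.sinh_pos_iff.2 hm
  have hC : 0 < Real.cosh m - 1 := sub_pos.2 (Real.one_lt_cosh.2 hm.ne')
  have hmS : 0 < m * Real.sinh m := mul_pos hm hS
  rw [lt_div_iff₀ hC]
  constructor
  · intro h
    have hK := aux_K m (1/2) hm (by norm_num) (by norm_num)
    set f : ℝ → ℝ := fun t => (Real.sinh (m * (1/2)) *
        (Real.sinh (m - m * t) * (m * Real.sinh m + lam * (1 - Real.cosh m)) -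
          lam * Real.sinh (m * t)) -
      lam * Real.sinh (m * t) * (Real.sinh (m - m * (1/2)) - Real.sinh m)) /
      (m * Real.sinh m * (m * Real.sinh m + lam * (1 - Real.cosh m))) with hf
    have hcs := Real.continuous_sinh
    have hfc : Continuous f := by
      apply Continuous.div_const
      fun_prop
    have hlim : 0 ≤ f 1 := by
      have ht : Filter.Tendsto f (nhdsWithin 1 (Iio 1)) (nhds (f 1)) :=
        (hfc.tendsto 1).mono_left nhdsWithin_le_nhds
      refine ge_of_tendsto ht ?_
      filter_upwards [Ioo_mem_nhdsLT (show (1/2:ℝ) < 1 by norm_num)] with t ht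
      have := h t ⟨by linarith [ht.1], ht.2⟩ (1/2) ⟨by norm_num, by norm_num⟩
      rw [Hm, if_pos ht.1.le] at this
      exact this.le
    have hf1 : f 1 = lam * (Real.sinh m *
        (Real.sinh m - Real.sinh (m * (1/2)) - Real.sinh (m - m * (1/2)))) /
        (m * Real.sinh m * (m * Real.sinh m + lam * (1 - Real.cosh m))) := by
      simp only [hf, mul_one, sub_self, Real.sinh_zero]
      congr 1
      ring
    rw [hf1] at hlim
    have hP := mul_pos hS hK
    rcases lt_or_gt_of_ne hD with hneg | hpos
    · exfalso
      have hl : 0 < lam := by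
        by_contra hc
        nlinarith
      exact absurd hlim (not_le.2 (div_neg_of_pos_of_neg (mul_pos hl hP)
        (mul_neg_of_pos_of_neg hmS hneg)))
    · refine ⟨?_, by linarith⟩
      by_contra hc
      exact absurd hlim (not_le.2 (div_neg_of_neg_of_pos
        (mul_neg_of_neg_of_pos (not_le.1 hc) hP) (mul_pos hmS hpos)))
  · rintro ⟨hl, hlt⟩ t ⟨ht0, ht1⟩ s ⟨hs0, hs1⟩
    have hpos : 0 < m * Real.sinh m + lam * (1 - Real.cosh m) := by linarith
    have hK := aux_K m s hm hs0 hs1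
    have hst : 0 < Real.sinh (m * t) := Real.sinh_pos_iff.2 (mul_pos hm ht0)
    have hss : 0 < Real.sinh (m * s) := Real.sinh_pos_iff.2 (mul_pos hm hs0)
    have hst' : 0 < Real.sinh (m - m * t) := Real.sinh_pos_iff.2 (by nlinarith)
    have hss' : 0 < Real.sinh (m - m * s) := Real.sinh_pos_iff.2 (by nlinarith)
    have hB := mul_nonneg hl (mul_pos hst hK).le
    unfold Hm
    split_ifs with hc
    · refine div_pos ?_ (mul_pos hmS hpos)
      have hA := mul_pos (mul_pos hss hst') hpos
      linarith
    · refine div_pos ?_ (mul_pos hmS hpos)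
      have hA := mul_pos (mul_pos hst hss') hpos
      linarith
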